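/- (Condorcet's Jury Theorem for consensus clustering, part 1) Let Z be an asymmetric partition with representation Z', let X_* be a hard partition with X_* ∈ A°_Z, and let X̄_* be the representation of X_* in optimal position with Z'. Let Q be a probability distribution on the finite set 𝒫⁺ of hard partitions whose support is contained in A°_Z, and let X₁, X₂, … be drawn i.i.d. from Q. For every n ≥ 1 the sample (X₁, …, Xₙ) has a unique mean partition Mₙ, and Mₙ has a unique representation in optimal position with X̄_*, so its vote Vₙ(j) := V_{Mₙ}(j) on each data point j is well defined; likewise V_X(j) is well defined for every X in the support of Q. Fix j ∈ {1, …, m} and set p_j = Q({X ∈ 𝒫⁺ : V_X(j) = 1}). Then lim_{n→∞} P(Vₙ(j) = 1) equals 1 if p_j > 1/2, equals 0 if p_j < 1/2, and equals 1/2 if p_j = 1/2. -/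

import Mathlib

/-!
Partition spaces for consensus clustering (Jain, "Condorcet's Jury Theorem for
Consensus Clustering").  Labeled partitions are ℓ×m column-stochastic matrices
with entries in [0,1]; the group Π of ℓ×ℓ permutation matrices acts by left
multiplication; partitions are orbits; δ is induced by the Frobenius norm.
-/

namespace CJT

/-- ℓ×m real matrices. -/
abbrev Mat (l m : ℕ) := Matrix (Fin l) (Fin m) ℝ

/-- `P` is an ℓ×ℓ permutation matrix. -/
def IsPermMatrix {l : ℕ} (P : Matrix (Fin l) (Fin l) ℝ) : Prop :=
  ∃ σ : Equiv.Perm (Fin l), ∀ i k, P i k = if σ i = k then 1 else 0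

/-- `X` is a labeled partition: entries in `[0,1]`, columns summing to one. -/
def IsLabeled {l m : ℕ} (X : Mat l m) : Prop :=
  (∀ i j, 0 ≤ X i j ∧ X i j ≤ 1) ∧ ∀ j, (∑ i, X i j) = 1

/-- The orbit `[X] = {P X : P ∈ Π}` of a labeled partition. -/
def orbit {l m : ℕ} (X : Mat l m) : Set (Mat l m) :=
  {Y | ∃ P : Matrix (Fin l) (Fin l) ℝ, IsPermMatrix P ∧ Y = P * X}

/-- The partition space 𝒫: all orbits of labeled partitions. -/
def PartitionSpace (l m : ℕ) : Set (Set (Mat l m)) :=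
  {A | ∃ X : Mat l m, IsLabeled X ∧ A = orbit X}

/-- Frobenius (Euclidean) norm. -/
noncomputable def frobNorm {l m : ℕ} (X : Mat l m) : ℝ :=
  Real.sqrt (∑ i, ∑ j, (X i j) ^ 2)

/-- `δ(A, B) = min {‖X' − Y'‖ : X' ∈ A, Y' ∈ B}`. -/
noncomputable def pdist {l m : ℕ} (A B : Set (Mat l m)) : ℝ :=
  sInf {d | ∃ X ∈ A, ∃ Y ∈ B, d = frobNorm (X - Y)}

/-- The Fréchet function `Fₙ(Z) = (1/n) Σᵢ δ(Xᵢ, Z)²` of a sample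
`𝒮ₙ = (X₁, …, Xₙ)` of `n` partitions. -/
noncomputable def frechet {l m n : ℕ} (s : Fin n → Set (Mat l m)) (A : Set (Mat l m)) : ℝ :=
  (1 / (n : ℝ)) * ∑ i, (pdist (s i) A) ^ 2

/-- A mean partition of the sample `s`: a global minimizer of the Fréchet
function over the partition space 𝒫. -/
def IsMeanPartition {l m n : ℕ} (s : Fin n → Set (Mat l m)) (M : Set (Mat l m)) : Prop :=
  M ∈ PartitionSpace l m ∧ ∀ W ∈ PartitionSpace l m, frechet s M ≤ frechet s W

/-- The degree of asymmetry
`α_Z = min {‖Z' − P Z'‖ : Z' ∈ Z, P ∈ Π, P ≠ I}` of a partition `Z`. -/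
noncomputable def asym {l m : ℕ} (A : Set (Mat l m)) : ℝ :=
  sInf {d | ∃ Z' ∈ A, ∃ P : Matrix (Fin l) (Fin l) ℝ,
    IsPermMatrix P ∧ P ≠ 1 ∧ d = frobNorm (Z' - P * Z')}

/-- A hard partition: a partition whose representations have all entries in
`{0, 1}`.  `𝒫⁺` is the set of hard partitions. -/
def IsHard {l m : ℕ} (A : Set (Mat l m)) : Prop :=
  A ∈ PartitionSpace l m ∧ ∀ X ∈ A, ∀ i j, X i j = 0 ∨ X i j = 1

/-- Measurable structure on the space of partitions (all sets measurable). -/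
instance {l m : ℕ} : MeasurableSpace (Set (Mat l m)) := ⊤

/-- The vote of a partition `A` on data point `j` is `1` iff the representation
`X'` of `A` in optimal position with the fixed ground-truth representation `Xb`
(`Xstar = π(Xb)`) satisfies `⟨x'_{:j}, x̄*_{:j}⟩ > 1/2`. -/
def VoteOne {l m : ℕ} (Xb : Mat l m) (Xstar A : Set (Mat l m)) (j : Fin m) : Prop :=
  ∀ X' ∈ A, frobNorm (X' - Xb) = pdist A Xstar →
    1 / 2 < ∑ k, X' k j * Xb k j

open MeasureTheory Filter

section Geometry

variable {l m : ℕ}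

/-- Permutation of the clusters: left multiplication by the permutation matrix of `σ`. -/
def permute (σ : Equiv.Perm (Fin l)) (X : Mat l m) : Mat l m := fun i j => X (σ i) j

lemma permute_permute (σ τ : Equiv.Perm (Fin l)) (X : Mat l m) :
    permute τ (permute σ X) = permute (σ * τ) X := rfl

lemma permute_one (X : Mat l m) : permute 1 X = X := rfl

lemma permute_sub (σ : Equiv.Perm (Fin l)) (X Y : Mat l m) :
    permute σ (X - Y) = permute σ X - permute σ Y := rfl

lemma mul_eq_permute {P : Matrix (Fin l) (Fin l) ℝ} {σ : Equiv.Perm (Fin l)}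
    (hP : ∀ i k, P i k = if σ i = k then 1 else 0) (X : Mat l m) :
    P * X = permute σ X := by
  ext i j
  simp [Matrix.mul_apply, hP, permute]

lemma mem_orbit_iff {X Y : Mat l m} : Y ∈ orbit X ↔ ∃ σ, Y = permute σ X := by
  constructor
  · rintro ⟨P, ⟨σ, hσ⟩, rfl⟩
    exact ⟨σ, mul_eq_permute hσ X⟩
  · rintro ⟨σ, rfl⟩
    exact ⟨fun i k => if σ i = k then 1 else 0, ⟨σ, fun _ _ => rfl⟩,
      (mul_eq_permute (fun _ _ => rfl) X).symm⟩

lemma self_mem_orbit (X : Mat l m) : X ∈ orbit X := mem_orbit_iff.2 ⟨1, rfl⟩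

lemma orbit_permute (σ : Equiv.Perm (Fin l)) (X : Mat l m) :
    orbit (permute σ X) = orbit X := by
  ext Y
  simp only [mem_orbit_iff, permute_permute]
  constructor
  · rintro ⟨τ, rfl⟩
    exact ⟨_, rfl⟩
  · rintro ⟨τ, rfl⟩
    exact ⟨σ⁻¹ * τ, by simp⟩

lemma orbit_eq_of_mem {X Y : Mat l m} (h : Y ∈ orbit X) : orbit X = orbit Y := by
  obtain ⟨σ, rfl⟩ := mem_orbit_iff.1 h
  exact (orbit_permute σ X).symm

lemma IsLabeled.permute {X : Mat l m} (hX : IsLabeled X) (σ : Equiv.Perm (Fin l)) :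
    IsLabeled (permute σ X) :=
  ⟨fun i j => hX.1 (σ i) j, fun j => (Equiv.sum_comp σ fun i => X i j).trans (hX.2 j)⟩

lemma eq_orbit_of_mem {A : Set (Mat l m)} (hA : A ∈ PartitionSpace l m) {X : Mat l m}
    (hX : X ∈ A) : A = orbit X ∧ IsLabeled X := by
  obtain ⟨Y, hY, rfl⟩ := hA
  refine ⟨orbit_eq_of_mem hX, ?_⟩
  obtain ⟨σ, rfl⟩ := mem_orbit_iff.1 hX
  exact hY.permute σ

lemma frobNorm_nonneg (X : Mat l m) : 0 ≤ frobNorm X := Real.sqrt_nonneg _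

lemma frobNorm_sq (X : Mat l m) : frobNorm X ^ 2 = ∑ i, ∑ j, X i j ^ 2 :=
  Real.sq_sqrt (by positivity)

/-- Matrices as vectors of a Euclidean space. -/
noncomputable def toEuclidean : Mat l m →ₗ[ℝ] EuclideanSpace ℝ (Fin l × Fin m) where
  toFun X := WithLp.toLp 2 fun p => X p.1 p.2
  map_add' _ _ := rfl
  map_smul' _ _ := rfl

lemma toEuclidean_apply (X : Mat l m) (p : Fin l × Fin m) : toEuclidean X p = X p.1 p.2 := rfl

lemma frobNorm_eq_norm (X : Mat l m) : frobNorm X = ‖toEuclidean X‖ := by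
  simp [frobNorm, toEuclidean_apply, EuclideanSpace.norm_eq, Fintype.sum_prod_type]

lemma frobNorm_sub_comm (X Y : Mat l m) : frobNorm (X - Y) = frobNorm (Y - X) := by
  rw [frobNorm_eq_norm, frobNorm_eq_norm, map_sub, map_sub, norm_sub_rev]

lemma frobNorm_sub_le (X Y W : Mat l m) :
    frobNorm (X - W) ≤ frobNorm (X - Y) + frobNorm (Y - W) := by
  simp only [frobNorm_eq_norm, map_sub]
  exact norm_sub_le_norm_sub_add_norm_sub _ _ _

lemma eq_zero_of_frobNorm_eq_zero {X : Mat l m} (h : frobNorm X = 0) : X = 0 := by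
  rw [frobNorm_eq_norm, norm_eq_zero] at h
  ext i j
  simpa [toEuclidean_apply] using congrArg (fun v => v.ofLp (i, j)) h

lemma frobNorm_permute (σ : Equiv.Perm (Fin l)) (X : Mat l m) :
    frobNorm (permute σ X) = frobNorm X := by
  unfold frobNorm
  congr 1
  exact Equiv.sum_comp σ fun i => ∑ j, X i j ^ 2

lemma pdist_le {A B : Set (Mat l m)} {X Y : Mat l m} (hX : X ∈ A) (hY : Y ∈ B) :
    pdist A B ≤ frobNorm (X - Y) := by
  refine csInf_le ⟨0, ?_⟩ ⟨X, hX, Y, hY, rfl⟩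
  rintro _ ⟨_, _, _, _, rfl⟩
  exact frobNorm_nonneg _

lemma frobNorm_permute_sub_permute (σ τ : Equiv.Perm (Fin l)) (X Y : Mat l m) :
    frobNorm (permute σ X - permute τ Y) = frobNorm (permute (σ * τ⁻¹) X - Y) := by
  rw [← frobNorm_permute τ (permute (σ * τ⁻¹) X - Y), permute_sub, permute_permute]
  simp

lemma exists_frobNorm_eq_pdist (X Y : Mat l m) :
    ∃ σ, frobNorm (permute σ X - Y) = pdist (orbit X) (orbit Y) := by
  obtain ⟨σ, hσ⟩ := Finite.exists_min fun σ : Equiv.Perm (Fin l) => frobNorm (permute σ X - Y)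
  refine ⟨σ, le_antisymm (le_csInf ⟨_, X, self_mem_orbit X, Y, self_mem_orbit Y, rfl⟩ ?_)
    (pdist_le (mem_orbit_iff.2 ⟨σ, rfl⟩) (self_mem_orbit Y))⟩
  rintro _ ⟨X', hX', Y', hY', rfl⟩
  obtain ⟨ρ, rfl⟩ := mem_orbit_iff.1 hX'
  obtain ⟨τ, rfl⟩ := mem_orbit_iff.1 hY'
  rw [frobNorm_permute_sub_permute]
  exact hσ _

/-- `Z` is moved by at least `a` by every nontrivial permutation. -/
def MovedBy (a : ℝ) (Z : Mat l m) : Prop :=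
  ∀ σ : Equiv.Perm (Fin l), σ ≠ 1 → a ≤ frobNorm (Z - permute σ Z)

lemma movedBy_asym {A : Set (Mat l m)} {Z : Mat l m} (hZ : Z ∈ A) : MovedBy (asym A) Z := by
  intro σ hσ
  refine csInf_le ⟨0, ?_⟩ ⟨Z, hZ, fun i k => if σ i = k then 1 else 0, ⟨σ, fun _ _ => rfl⟩, ?_, ?_⟩
  · rintro _ ⟨_, _, _, _, _, rfl⟩
    exact frobNorm_nonneg _
  · intro h
    refine hσ (Equiv.ext fun i => ?_)
    by_contra hne
    have := congrFun (congrFun h i) i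
    simp_all
  · rw [mul_eq_permute (fun _ _ => rfl)]

variable {a : ℝ} {Z X Y : Mat l m}

lemma MovedBy.lt_frobNorm (hZ : MovedBy a Z) (hX : frobNorm (X - Z) < a / 4)
    (hY : frobNorm (Y - Z) < a / 4) {σ : Equiv.Perm (Fin l)} (hσ : σ ≠ 1) :
    frobNorm (X - Y) < frobNorm (permute σ X - Y) := by
  have h₁ := hZ σ hσ
  have h₂ := frobNorm_sub_le Z Y (permute σ Z)
  have h₃ := frobNorm_sub_le Y (permute σ X) (permute σ Z)
  have h₄ := frobNorm_sub_le X Z Y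
  rw [← permute_sub, frobNorm_permute, frobNorm_sub_comm Y (permute σ X)] at h₃
  rw [frobNorm_sub_comm Z Y] at h₂ h₄
  linarith

lemma MovedBy.pdist_eq (hZ : MovedBy a Z) (hX : frobNorm (X - Z) < a / 4)
    (hY : frobNorm (Y - Z) < a / 4) : pdist (orbit X) (orbit Y) = frobNorm (X - Y) := by
  refine le_antisymm (pdist_le (self_mem_orbit X) (self_mem_orbit Y)) ?_
  obtain ⟨σ, hσ⟩ := exists_frobNorm_eq_pdist X Y
  rw [← hσ]
  rcases eq_or_ne σ 1 with rfl | h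
  · exact le_rfl
  · exact (hZ.lt_frobNorm hX hY h).le

lemma MovedBy.le_frobNorm (hZ : MovedBy a Z) (hX : frobNorm (X - Z) < a / 4)
    (hY : frobNorm (Y - Z) < a / 4) (σ τ : Equiv.Perm (Fin l)) :
    frobNorm (X - Y) ≤ frobNorm (permute σ X - permute τ Y) := by
  rw [← hZ.pdist_eq hX hY]
  exact pdist_le (mem_orbit_iff.2 ⟨σ, rfl⟩) (mem_orbit_iff.2 ⟨τ, rfl⟩)

lemma MovedBy.eq_of_frobNorm_eq (hZ : MovedBy a Z) (hX : frobNorm (X - Z) < a / 4)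
    (hY : frobNorm (Y - Z) < a / 4) {σ τ : Equiv.Perm (Fin l)}
    (h : frobNorm (permute σ X - permute τ Y) = frobNorm (X - Y)) : σ = τ := by
  rw [frobNorm_permute_sub_permute] at h
  by_contra hne
  exact (hZ.lt_frobNorm hX hY (mt mul_inv_eq_one.1 hne)).ne' h

/-- Inside the asymmetry ball, the representation nearest to `Z` is the only one in optimal
position with the nearby representation of another partition of the ball. -/
lemma MovedBy.optimal_iff (hZ : MovedBy a Z) (hX : frobNorm (X - Z) < a / 4)
    (hY : frobNorm (Y - Z) < a / 4) {X' : Mat l m} :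
    (X' ∈ orbit X ∧ frobNorm (X' - Y) = pdist (orbit X) (orbit Y)) ↔ X' = X := by
  rw [hZ.pdist_eq hX hY]
  constructor
  · rintro ⟨h, h'⟩
    obtain ⟨σ, rfl⟩ := mem_orbit_iff.1 h
    rw [hZ.eq_of_frobNorm_eq hX hY (σ := σ) (τ := 1) h', permute_one]
  · rintro rfl
    exact ⟨self_mem_orbit _, rfl⟩

lemma sum_sum_sub_sq {n : ℕ} (f : Fin n → ℝ) :
    ∑ i, ∑ k, (f i - f k) ^ 2 = 2 * (n * ∑ i, f i ^ 2) - 2 * (∑ i, f i) ^ 2 := by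
  simp only [sub_sq, Finset.sum_add_distrib, Finset.sum_sub_distrib, ← Finset.mul_sum,
    ← Finset.sum_mul, Finset.sum_const, Finset.card_univ, Fintype.card_fin, nsmul_eq_mul]
  ring

lemma sum_sum_frobNorm_sub_sq {n : ℕ} (y : Fin n → Mat l m) :
    ∑ i, ∑ k, frobNorm (y i - y k) ^ 2 =
      2 * (n * ∑ i, frobNorm (y i) ^ 2) - 2 * frobNorm (∑ i, y i) ^ 2 := by
  have h := fun p q => sum_sum_sub_sq fun i => y i p q
  have h' : ∑ p, ∑ q, ∑ i, ∑ k, (y i p q - y k p q) ^ 2 =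
      ∑ p, ∑ q, (2 * (n * ∑ i, y i p q ^ 2) - 2 * (∑ i, y i p q) ^ 2) := by simp only [h]
  simp only [frobNorm_sq, Matrix.sub_apply, Matrix.sum_apply]
  have swap : ∀ f : Fin n → Fin l → Fin m → ℝ,
      ∑ i, ∑ p, ∑ q, f i p q = ∑ p, ∑ q, ∑ i, f i p q := fun f => by
    rw [Finset.sum_comm]
    exact Finset.sum_congr rfl fun p _ => Finset.sum_comm
  have e₁ : ∑ i, ∑ k, ∑ p, ∑ q, (y i p q - y k p q) ^ 2 =
      ∑ p, ∑ q, ∑ i, ∑ k, (y i p q - y k p q) ^ 2 := by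
    rw [← swap]
    exact Finset.sum_congr rfl fun i _ => swap _
  rw [e₁, h', swap fun i p q => y i p q ^ 2]
  simp only [Finset.sum_sub_distrib, ← Finset.mul_sum]

/-- The entrywise average of a family of matrices. -/
noncomputable def average {n : ℕ} (x : Fin n → Mat l m) : Mat l m := (n : ℝ)⁻¹ • ∑ i, x i

lemma average_apply {n : ℕ} (x : Fin n → Mat l m) (p : Fin l) (q : Fin m) :
    average x p q = (n : ℝ)⁻¹ * ∑ i, x i p q := by
  simp [average, Matrix.sum_apply]

lemma isLabeled_average {n : ℕ} (hn : 0 < n) {x : Fin n → Mat l m}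
    (hx : ∀ i, IsLabeled (x i)) : IsLabeled (average x) := by
  have hn' : (0 : ℝ) < n := by exact_mod_cast hn
  have key : ∀ q, ∑ p, average x p q = 1 := fun q => by
    simp only [average_apply, ← Finset.mul_sum]
    rw [Finset.sum_comm]
    simp [(hx _).2, hn'.ne']
  have nn : ∀ p q, 0 ≤ average x p q := fun p q => by
    rw [average_apply]
    exact mul_nonneg (by positivity) (Finset.sum_nonneg fun i _ => ((hx i).1 p q).1)
  exact ⟨fun p q => ⟨nn p q, key q ▸
    Finset.single_le_sum (f := fun p => average x p q) (fun p _ => nn p q) (Finset.mem_univ p)⟩, key⟩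

lemma sum_sub_const {n : ℕ} (hn : 0 < n) (x : Fin n → Mat l m) (w : Mat l m) :
    ∑ i, (x i - w) = (n : ℝ) • (average x - w) := by
  have hn' : (n : ℝ) ≠ 0 := by positivity
  ext p q
  simp only [Matrix.sum_apply, Matrix.sub_apply, Matrix.smul_apply, average_apply,
    Finset.sum_sub_distrib, smul_eq_mul]
  field_simp
  simp

lemma frobNorm_average_sub_lt {n : ℕ} (hn : 0 < n) {x : Fin n → Mat l m} {r : ℝ}
    (hx : ∀ i, frobNorm (x i - Z) < r) : frobNorm (average x - Z) < r := by
  have hn' : (0 : ℝ) < n := by exact_mod_cast hn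
  have he : ∀ i, toEuclidean (x i) ∈ Metric.ball (toEuclidean Z) r := fun i => by
    rw [mem_ball_iff_norm, ← map_sub, ← frobNorm_eq_norm]
    exact hx i
  have := (convex_ball (toEuclidean Z) r).sum_mem (t := Finset.univ)
    (w := fun _ : Fin n => (n : ℝ)⁻¹) (fun _ _ => by positivity) (by simp [hn'.ne'])
    (fun i _ => he i)
  rwa [mem_ball_iff_norm, ← Finset.smul_sum, ← map_sum, ← map_smul, ← map_sub,
    ← frobNorm_eq_norm] at this

/-- A sample of the asymmetry ball has the orbit of the average of the representations nearest
to `Z` as its only mean partition. -/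
lemma MovedBy.isMeanPartition_iff (hZ : MovedBy a Z) {n : ℕ} (hn : 0 < n) {x : Fin n → Mat l m}
    (hlab : ∀ i, IsLabeled (x i)) (hx : ∀ i, frobNorm (x i - Z) < a / 4) (M : Set (Mat l m)) :
    IsMeanPartition (fun i => orbit (x i)) M ↔ M = orbit (average x) := by
  have hn' : (0 : ℝ) < n := by exact_mod_cast hn
  have hmean : orbit (average x) ∈ PartitionSpace l m := ⟨_, isLabeled_average hn hlab, rfl⟩
  have upper : ∑ i, pdist (orbit (x i)) (orbit (average x)) ^ 2 =
      ∑ i, frobNorm (x i - average x) ^ 2 :=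
    Finset.sum_congr rfl fun i _ => by
      rw [hZ.pdist_eq (hx i) (frobNorm_average_sub_lt hn hx)]
  have pairs : ∑ i, ∑ k, frobNorm (x i - x k) ^ 2 =
      2 * (n * ∑ i, frobNorm (x i - average x) ^ 2) := by
    have h := sum_sum_frobNorm_sub_sq fun i => x i - average x
    simpa [sum_sub_const hn, frobNorm] using h
  have lower : ∀ W ∈ PartitionSpace l m,
      ∑ i, pdist (orbit (x i)) (orbit (average x)) ^ 2 ≤ ∑ i, pdist (orbit (x i)) W ^ 2 ∧
      (∑ i, pdist (orbit (x i)) W ^ 2 ≤ ∑ i, pdist (orbit (x i)) (orbit (average x)) ^ 2 →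
        W = orbit (average x)) := by
    rintro _ ⟨w, -, rfl⟩
    choose σ hσ using fun i => exists_frobNorm_eq_pdist (x i) w
    have h := sum_sum_frobNorm_sub_sq fun i => permute (σ i) (x i) - w
    simp only [sub_sub_sub_cancel_right, hσ] at h
    have hle : ∀ i k, frobNorm (x i - x k) ^ 2 ≤
        frobNorm (permute (σ i) (x i) - permute (σ k) (x k)) ^ 2 := fun i k =>
      pow_le_pow_left₀ (frobNorm_nonneg _) (hZ.le_frobNorm (hx i) (hx k) _ _) 2
    have hle' : ∑ i, ∑ k, frobNorm (x i - x k) ^ 2 ≤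
        ∑ i, ∑ k, frobNorm (permute (σ i) (x i) - permute (σ k) (x k)) ^ 2 :=
      Finset.sum_le_sum fun i _ => Finset.sum_le_sum fun k _ => hle i k
    have hsq := sq_nonneg (frobNorm (∑ i, (permute (σ i) (x i) - w)))
    rw [upper]
    refine ⟨le_of_mul_le_mul_left (by linarith) hn', fun heq => ?_⟩
    have heq' := mul_le_mul_of_nonneg_left heq hn'.le
    have hzero : frobNorm (∑ i, (permute (σ i) (x i) - w)) = 0 := by
      rw [← sq_eq_zero_iff]
      linarith
    have hsum : ∑ i, ∑ k, frobNorm (x i - x k) ^ 2 =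
        ∑ i, ∑ k, frobNorm (permute (σ i) (x i) - permute (σ k) (x k)) ^ 2 := by linarith
    have hσσ : ∀ i k, σ i = σ k := fun i k => by
      rw [Finset.sum_eq_sum_iff_of_le fun i _ => Finset.sum_le_sum fun k _ => hle i k] at hsum
      have h₁ := hsum i (Finset.mem_univ i)
      rw [Finset.sum_eq_sum_iff_of_le fun k _ => hle i k] at h₁
      have h₂ := h₁ k (Finset.mem_univ k)
      rw [sq_eq_sq₀ (frobNorm_nonneg _) (frobNorm_nonneg _)] at h₂
      exact hZ.eq_of_frobNorm_eq (hx i) (hx k) h₂.symm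
    have hw := eq_zero_of_frobNorm_eq_zero hzero
    rw [sum_sub_const hn, smul_eq_zero, or_iff_right hn'.ne', sub_eq_zero] at hw
    rw [← hw, ← orbit_permute (σ ⟨0, hn⟩) (average x)]
    congr 1
    ext p q
    simp only [average_apply, permute, hσσ _ ⟨0, hn⟩]
  have hfr : ∀ A B : Set (Mat l m), frechet (fun i => orbit (x i)) A ≤
      frechet (fun i => orbit (x i)) B ↔
      ∑ i, pdist (orbit (x i)) A ^ 2 ≤ ∑ i, pdist (orbit (x i)) B ^ 2 := fun A B =>
    mul_le_mul_iff_right₀ (by positivity)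
  constructor
  · rintro ⟨hM, hmin⟩
    exact (lower M hM).2 ((hfr _ _).1 (hmin _ hmean))
  · rintro rfl
    exact ⟨hmean, fun W hW => (hfr _ _).2 (lower W hW).1⟩

lemma exists_eq_single {X : Mat l m} (hX : IsLabeled X) (hard : ∀ i j, X i j = 0 ∨ X i j = 1)
    (j : Fin m) : ∃ k, ∀ i, X i j = if i = k then 1 else 0 := by
  have hne : ∃ k, X k j = 1 := by
    by_contra! h
    have h0 := hX.2 j
    rw [Finset.sum_eq_zero fun i _ => (hard i j).resolve_right (h i)] at h0
    exact zero_ne_one h0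
  obtain ⟨k, hk⟩ := hne
  refine ⟨k, fun i => ?_⟩
  have hsum := hX.2 j
  rw [← Finset.add_sum_erase _ _ (Finset.mem_univ k), hk, add_eq_left,
    Finset.sum_eq_zero_iff_of_nonneg fun i _ => (hX.1 i j).1] at hsum
  split_ifs with h
  · rw [h, hk]
  · exact hsum i (Finset.mem_erase.2 ⟨h, Finset.mem_univ i⟩)

lemma inner_eq_zero_or_one (hX : IsLabeled X) (hardX : ∀ i j, X i j = 0 ∨ X i j = 1)
    (hardY : ∀ i j, Y i j = 0 ∨ Y i j = 1) (j : Fin m) :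
    ∑ k, X k j * Y k j = 0 ∨ ∑ k, X k j * Y k j = 1 := by
  obtain ⟨k, hk⟩ := exists_eq_single hX hardX j
  simpa [hk] using hardY k j

open Classical in
/-- The average of `n` numbers in `{0, 1}` exceeds `1/2` iff more than half of them do. -/
lemma half_lt_mean_iff {n : ℕ} (hn : 0 < n) (v : Fin n → ℝ) (hv : ∀ i, v i = 0 ∨ v i = 1) :
    1 / 2 < (n : ℝ)⁻¹ * ∑ i, v i ↔ n < 2 * (Finset.univ.filter fun i => 1 / 2 < v i).card := by
  have hn' : (0 : ℝ) < n := by exact_mod_cast hn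
  have hsum : ∑ i, v i = ((Finset.univ.filter fun i => 1 / 2 < v i).card : ℝ) := by
    rw [Finset.card_filter, Nat.cast_sum]
    refine Finset.sum_congr rfl fun i _ => ?_
    rcases hv i with h | h <;> norm_num [h]
  rw [hsum, ← Nat.cast_lt (α := ℝ), inv_mul_eq_div, lt_div_iff₀ hn']
  push_cast
  constructor <;> intro h <;> linarith

end Geometry

section Binomial

/-- The probability of `k` successes in `n` independent trials of success probability `p`. -/
noncomputable def binomialWeight (p : ℝ) (n k : ℕ) : ℝ := n.choose k * p ^ k * (1 - p) ^ (n - k)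

/-- The probability of more than `n / 2` successes in `n` independent trials. -/
noncomputable def majorityProb (p : ℝ) (n : ℕ) : ℝ :=
  ∑ k ∈ Finset.range (n + 1) with n < 2 * k, binomialWeight p n k

variable {p : ℝ}

lemma binomialWeight_nonneg (h₀ : 0 ≤ p) (h₁ : p ≤ 1) (n k : ℕ) : 0 ≤ binomialWeight p n k := by
  have : 0 ≤ 1 - p := by linarith
  unfold binomialWeight
  positivity

lemma sum_binomialWeight (p : ℝ) (n : ℕ) :
    ∑ k ∈ Finset.range (n + 1), binomialWeight p n k = 1 := by
  have h := add_pow p (1 - p) n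
  rw [add_sub_cancel, one_pow] at h
  rw [h]
  exact Finset.sum_congr rfl fun k _ => by unfold binomialWeight; ring

lemma binomialWeight_variance (p : ℝ) (n : ℕ) :
    ∑ k ∈ Finset.range (n + 1), (n * p - k) ^ 2 * binomialWeight p n k = n * p * (1 - p) := by
  have h := congrArg (Polynomial.eval p) (bernsteinPolynomial.variance ℝ n)
  simpa [Polynomial.eval_finsetSum, bernsteinPolynomial, binomialWeight] using h

/-- Chebyshev's inequality for the binomial distribution. -/
lemma sum_binomialWeight_le (h₀ : 0 ≤ p) (h₁ : p ≤ 1) {n : ℕ} (hn : 0 < n) {c : ℝ} (hc : 0 < c)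
    {s : Finset ℕ} (hs : s ⊆ Finset.range (n + 1))
    (hdev : ∀ k ∈ s, (n * c) ^ 2 ≤ (n * p - k) ^ 2) :
    ∑ k ∈ s, binomialWeight p n k ≤ p * (1 - p) / c ^ 2 / n := by
  have hn' : (0 : ℝ) < n := by exact_mod_cast hn
  have hw := binomialWeight_nonneg h₀ h₁ n
  have h : (n * c) ^ 2 * ∑ k ∈ s, binomialWeight p n k ≤ n * p * (1 - p) := by
    rw [← binomialWeight_variance, Finset.mul_sum]
    exact (Finset.sum_le_sum fun k hk => mul_le_mul_of_nonneg_right (hdev k hk) (hw k)).trans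
      (Finset.sum_le_sum_of_subset_of_nonneg hs fun k _ _ => mul_nonneg (sq_nonneg _) (hw k))
  rw [div_div, le_div_iff₀ (by positivity)]
  refine le_of_mul_le_mul_left ?_ hn'
  linarith

lemma majorityProb_nonneg (h₀ : 0 ≤ p) (h₁ : p ≤ 1) (n : ℕ) : 0 ≤ majorityProb p n :=
  Finset.sum_nonneg fun k _ => binomialWeight_nonneg h₀ h₁ n k

lemma majorityProb_add_sum (p : ℝ) (n : ℕ) :
    majorityProb p n +
      ∑ k ∈ Finset.range (n + 1) with ¬ n < 2 * k, binomialWeight p n k = 1 := by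
  rw [majorityProb, Finset.sum_filter_add_sum_filter_not, sum_binomialWeight]

lemma tendsto_const_div_natCast (c : ℝ) : Tendsto (fun n : ℕ => c / n) atTop (nhds 0) :=
  tendsto_const_nhds.div_atTop tendsto_natCast_atTop_atTop

lemma tendsto_majorityProb_of_lt (h₀ : 0 ≤ p) (h : p < 1 / 2) :
    Tendsto (majorityProb p) atTop (nhds 0) := by
  have h₁ : p ≤ 1 := by linarith
  refine squeeze_zero' (.of_forall (majorityProb_nonneg h₀ h₁)) ?_
    (tendsto_const_div_natCast (p * (1 - p) / (1 / 2 - p) ^ 2))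
  filter_upwards [eventually_gt_atTop 0] with n hn
  refine sum_binomialWeight_le h₀ h₁ hn (by linarith) (Finset.filter_subset _ _) fun k hk => ?_
  have hk' : (n : ℝ) < 2 * k := by exact_mod_cast (Finset.mem_filter.1 hk).2
  rw [← neg_sub (k : ℝ), neg_sq]
  exact pow_le_pow_left₀ (mul_nonneg n.cast_nonneg (by linarith)) (by linarith) 2

lemma tendsto_majorityProb_of_gt (h₁ : p ≤ 1) (h : 1 / 2 < p) :
    Tendsto (majorityProb p) atTop (nhds 1) := by
  have h₀ : 0 ≤ p := by linarith
  have hminor : Tendsto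
      (fun n : ℕ => ∑ k ∈ Finset.range (n + 1) with ¬ n < 2 * k, binomialWeight p n k)
      atTop (nhds 0) := by
    refine squeeze_zero'
      (.of_forall fun n => Finset.sum_nonneg fun k _ => binomialWeight_nonneg h₀ h₁ n k) ?_
      (tendsto_const_div_natCast (p * (1 - p) / (p - 1 / 2) ^ 2))
    filter_upwards [eventually_gt_atTop 0] with n hn
    refine sum_binomialWeight_le h₀ h₁ hn (by linarith) (Finset.filter_subset _ _) fun k hk => ?_
    have hk' : 2 * (k : ℝ) ≤ n := by exact_mod_cast not_lt.1 (Finset.mem_filter.1 hk).2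
    exact pow_le_pow_left₀ (mul_nonneg n.cast_nonneg (by linarith)) (by linarith) 2
  rw [← sub_zero (1 : ℝ)]
  exact (tendsto_const_nhds.sub hminor).congr fun n =>
    (eq_sub_of_add_eq (majorityProb_add_sum p n)).symm

lemma centralBinom_sq_mul_le (n : ℕ) : n.centralBinom ^ 2 * (2 * n + 1) ≤ 16 ^ n := by
  induction n with
  | zero => simp
  | succ n ih =>
    have h := Nat.succ_mul_centralBinom_succ n
    refine le_of_mul_le_mul_left (a := (n + 1) ^ 2) ?_ (by positivity)
    calc (n + 1) ^ 2 * ((n + 1).centralBinom ^ 2 * (2 * (n + 1) + 1))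
        = ((n + 1) * (n + 1).centralBinom) ^ 2 * (2 * n + 3) := by ring
      _ = (n.centralBinom ^ 2 * (2 * n + 1)) * (4 * ((2 * n + 1) * (2 * n + 3))) := by
          rw [h]; ring
      _ ≤ 16 ^ n * (16 * (n + 1) ^ 2) := Nat.mul_le_mul ih (by nlinarith)
      _ = (n + 1) ^ 2 * 16 ^ (n + 1) := by ring

lemma binomialWeight_half {n k : ℕ} (hk : k ≤ n) :
    binomialWeight (1 / 2) n k = n.choose k / 2 ^ n := by
  rw [binomialWeight, sub_half, mul_assoc, ← pow_add, Nat.add_sub_cancel' hk, one_div, inv_pow,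
    div_eq_mul_inv]

/-- The probability of a tie in `n` tosses of a fair coin. -/
noncomputable def tieProb (n : ℕ) : ℝ :=
  ∑ k ∈ Finset.range (n + 1) with n = 2 * k, binomialWeight (1 / 2) n k

lemma tieProb_sq_le (n : ℕ) : tieProb n ^ 2 ≤ 1 / (n + 1) := by
  unfold tieProb
  rcases Nat.even_or_odd' n with ⟨r, rfl | rfl⟩
  · have hfil : (Finset.range (2 * r + 1)).filter (fun k => 2 * r = 2 * k) = {r} := by
      ext k
      simp only [Finset.mem_filter, Finset.mem_range, Finset.mem_singleton]
      lia
    rw [hfil, Finset.sum_singleton, binomialWeight_half (by lia)]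
    have h : ((r.centralBinom : ℝ)) ^ 2 * (2 * r + 1) ≤ 16 ^ r := by
      exact_mod_cast centralBinom_sq_mul_le r
    rw [← Nat.centralBinom_eq_two_mul_choose, div_pow, ← pow_mul,
      show 2 * r * 2 = 4 * r by ring, pow_mul, div_le_div_iff₀ (by positivity) (by positivity)]
    push_cast
    norm_num
    exact h
  · have hfil : (Finset.range (2 * r + 1 + 1)).filter (fun k => 2 * r + 1 = 2 * k) = ∅ := by
      ext k
      simp
      lia
    rw [hfil, Finset.sum_empty, zero_pow two_ne_zero]
    positivity

lemma tendsto_tieProb : Tendsto tieProb atTop (nhds 0) := by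
  have h : Tendsto (fun n => tieProb n ^ 2) atTop (nhds 0) :=
    squeeze_zero (fun n => sq_nonneg _) tieProb_sq_le tendsto_one_div_add_atTop_nhds_zero_nat
  have h' := (Real.continuous_sqrt.tendsto 0).comp h
  rw [Real.sqrt_zero] at h'
  refine h'.congr fun n => Real.sqrt_sq ?_
  exact Finset.sum_nonneg fun k _ => binomialWeight_nonneg (by norm_num) (by norm_num) n k

lemma two_mul_majorityProb_half (n : ℕ) : 2 * majorityProb (1 / 2) n + tieProb n = 1 := by
  have hflip : ∑ k ∈ Finset.range (n + 1) with 2 * k < n, binomialWeight (1 / 2) n k =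
      majorityProb (1 / 2) n := by
    refine Finset.sum_nbij' (n - ·) (n - ·) ?_ ?_ ?_ ?_ ?_ <;>
      simp only [Finset.mem_filter, Finset.mem_range] <;> intro k hk
    any_goals lia
    rw [binomialWeight_half (by lia), binomialWeight_half (by lia), Nat.choose_symm (by lia)]
  have hsplit : ∑ k ∈ Finset.range (n + 1) with ¬ n < 2 * k, binomialWeight (1 / 2) n k =
      (∑ k ∈ Finset.range (n + 1) with 2 * k < n, binomialWeight (1 / 2) n k) + tieProb n := by
    rw [tieProb, ← Finset.sum_union]
    · congr 1
      ext k
      simp only [Finset.mem_union, Finset.mem_filter, Finset.mem_range]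
      lia
    · rw [Finset.disjoint_filter]
      lia
  linarith [majorityProb_add_sum (1 / 2) n]

lemma tendsto_majorityProb_half : Tendsto (majorityProb (1 / 2)) atTop (nhds (1 / 2)) := by
  have h := (tendsto_tieProb.const_sub 1).div_const 2
  rw [sub_zero] at h
  exact h.congr fun n => by linarith [two_mul_majorityProb_half n]

end Binomial

section ProductMeasure

variable {Ω : Type*} [MeasurableSpace Ω] (Q : Measure Ω) [IsProbabilityMeasure Q]

open Classical in
lemma pi_majority_eq {B : Set Ω} (hB : MeasurableSet B) (n : ℕ) :
    (Measure.pi fun _ : Fin n => Q).real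
      {s | n < 2 * (Finset.univ.filter fun i => s i ∈ B).card} = majorityProb (Q.real B) n := by
  let box : Finset (Fin n) → Set (Fin n → Ω) := fun T =>
    Set.univ.pi fun i => if i ∈ T then B else Bᶜ
  have mem_box : ∀ T s, s ∈ box T ↔ Finset.univ.filter (fun i => s i ∈ B) = T := fun T s => by
    simp only [box, Set.mem_univ_pi, Finset.ext_iff, Finset.mem_filter, Finset.mem_univ, true_and]
    refine forall_congr' fun i => ?_
    by_cases h : i ∈ T <;> simp [h]
  have hbox : ∀ T, (Measure.pi fun _ : Fin n => Q).real (box T) =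
      Q.real B ^ T.card * (1 - Q.real B) ^ (n - T.card) := fun T => by
    rw [measureReal_def, Measure.pi_pi, ENNReal.toReal_prod]
    have : ∀ i, (Q (if i ∈ T then B else Bᶜ)).toReal =
        if i ∈ T then Q.real B else 1 - Q.real B := fun i => by
      split_ifs
      · rfl
      · exact probReal_compl_eq_one_sub hB
    simp only [this, Finset.prod_ite, Finset.prod_const]
    congr 2
    · simp
    · rw [Finset.filter_not, Finset.card_sdiff]
      simp
  have hunion : {s : Fin n → Ω | n < 2 * (Finset.univ.filter fun i => s i ∈ B).card} =
      ⋃ T ∈ (Finset.univ : Finset (Finset (Fin n))).filter (fun T => n < 2 * T.card), box T := by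
    ext s
    simp [mem_box]
  rw [hunion, measureReal_biUnion_finset, Finset.sum_congr rfl fun T _ => hbox T,
    Finset.sum_filter, ← Finset.powerset_univ,
    Finset.sum_powerset_apply_card (fun k => if n < 2 * k then
      Q.real B ^ k * (1 - Q.real B) ^ (n - k) else 0), Finset.card_univ, Fintype.card_fin,
    majorityProb, Finset.sum_filter]
  · refine Finset.sum_congr rfl fun k _ => ?_
    simp only [binomialWeight, nsmul_eq_mul, mul_ite, mul_zero, mul_assoc]
  · intro T _ T' _ hne
    refine Set.disjoint_left.2 fun s hs hs' => hne ?_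
    rw [← (mem_box T s).1 hs, (mem_box T' s).1 hs']
  · intro T _
    refine MeasurableSet.univ_pi fun i => ?_
    split_ifs
    exacts [hB, hB.compl]

end ProductMeasure

/-- **Condorcet's Jury Theorem for consensus clustering, part 1.**
Let `Z` be an asymmetric partition with representation `Z'`, `X_*` a hard
partition in the open asymmetry ball `A°_Z`, and `X̄_*` the representation of
`X_*` in optimal position with `Z'`.  Let `Q` be a probability distribution on
the hard partitions whose support is contained in `A°_Z`, and draw samples
i.i.d. from `Q` (the `n`-sample living under the `n`-fold product of `Q`).
Then every sample from the support has a unique mean partition with a unique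
representation in optimal position with `X̄_*` (so the majority vote `Vₙ(j)` is
well defined), and for each data point `j`, with
`p_j = Q({X ∈ 𝒫⁺ : V_X(j) = 1})`, the probability `P(Vₙ(j) = 1)` tends to `1`
if `p_j > 1/2`, to `0` if `p_j < 1/2`, and to `1/2` if `p_j = 1/2`. -/
theorem condorcet_jury_theorem_part1 (l m : ℕ) (hl : 1 ≤ l) (hm : 1 ≤ m)
    (Z : Set (Mat l m)) (hZ : Z ∈ PartitionSpace l m) (hasym : 0 < asym Z)
    (Z' : Mat l m) (hZ' : Z' ∈ Z)
    (Xstar : Set (Mat l m)) (hXstarHard : IsHard Xstar)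
    (hXstarBall : pdist Xstar Z < asym Z / 4)
    (Xb : Mat l m) (hXb : Xb ∈ Xstar) (hXbOpt : frobNorm (Xb - Z') = pdist Xstar Z)
    (Q : Measure (Set (Mat l m))) [IsProbabilityMeasure Q]
    (hsupp : Q {A | IsHard A ∧ pdist A Z < asym Z / 4} = 1)
    (j : Fin m) (pj : ℝ)
    (hpj : pj = (Q {A | IsHard A ∧ VoteOne Xb Xstar A j}).toReal) :
    -- mean partitions of samples from the support are unique and have a unique
    -- representation in optimal position with X̄_*, so the majority vote is
    -- well defined
    (∀ n : ℕ, 0 < n → ∀ s : Fin n → Set (Mat l m),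
      (∀ i, IsHard (s i) ∧ pdist (s i) Z < asym Z / 4) →
      (∃! M, IsMeanPartition s M) ∧
      (∀ M, IsMeanPartition s M →
        ∃! M', M' ∈ M ∧ frobNorm (M' - Xb) = pdist M Xstar)) ∧
    -- the asymptotic behaviour of P(Vₙ(j) = 1) under the n-fold product of Q
    ((1 / 2 < pj → Tendsto (fun n : ℕ =>
        ((Measure.pi fun _ : Fin n => Q)
          {s | ∀ M, IsMeanPartition s M → ∀ M' ∈ M,
            frobNorm (M' - Xb) = pdist M Xstar →
              1 / 2 < ∑ k, M' k j * Xb k j}).toReal)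
        atTop (nhds 1)) ∧
     (pj < 1 / 2 → Tendsto (fun n : ℕ =>
        ((Measure.pi fun _ : Fin n => Q)
          {s | ∀ M, IsMeanPartition s M → ∀ M' ∈ M,
            frobNorm (M' - Xb) = pdist M Xstar →
              1 / 2 < ∑ k, M' k j * Xb k j}).toReal)
        atTop (nhds 0)) ∧
     (pj = 1 / 2 → Tendsto (fun n : ℕ =>
        ((Measure.pi fun _ : Fin n => Q)
          {s | ∀ M, IsMeanPartition s M → ∀ M' ∈ M,
            frobNorm (M' - Xb) = pdist M Xstar →
              1 / 2 < ∑ k, M' k j * Xb k j}).toReal)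
        atTop (nhds (1 / 2)))) := by
  have hmoved := movedBy_asym hZ'
  obtain rfl := (eq_orbit_of_mem hXstarHard.1 hXb).1
  obtain ⟨hZeq, -⟩ := eq_orbit_of_mem hZ hZ'
  rw [← hXbOpt] at hXstarBall
  have hgood : ∀ A, IsHard A ∧ pdist A Z < asym Z / 4 → ∃ x, A = orbit x ∧ IsLabeled x ∧
      frobNorm (x - Z') < asym Z / 4 ∧ ∀ i j, x i j = 0 ∨ x i j = 1 := by
    rintro A ⟨⟨⟨y, hy, rfl⟩, hard⟩, hball⟩
    obtain ⟨σ, hσ⟩ := exists_frobNorm_eq_pdist y Z'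
    rw [← hZeq] at hσ
    exact ⟨permute σ y, (orbit_permute σ y).symm, hy.permute σ, hσ ▸ hball,
      hard _ (mem_orbit_iff.2 ⟨σ, rfl⟩)⟩
  classical
  set B : Set (Set (Mat l m)) := {A | IsHard A ∧ VoteOne Xb (orbit Xb) A j}
  have hvote : ∀ n : ℕ, 0 < n → ∀ s : Fin n → Set (Mat l m),
      (∀ i, IsHard (s i) ∧ pdist (s i) Z < asym Z / 4) →
      ((∀ M, IsMeanPartition s M → ∀ M' ∈ M, frobNorm (M' - Xb) = pdist M (orbit Xb) →
        1 / 2 < ∑ k, M' k j * Xb k j) ↔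
      n < 2 * (Finset.univ.filter fun i => s i ∈ B).card) := by
    intro n hn s hs
    choose x hsx hlab hx hard using fun i => hgood (s i) (hs i)
    have hmemB : ∀ i, s i ∈ B ↔ 1 / 2 < ∑ k, x i k j * Xb k j := fun i => by
      have hB : s i ∈ B ↔ VoteOne Xb (orbit Xb) (s i) j := and_iff_right (hs i).1
      rw [hB, hsx i]
      simp only [VoteOne, ← and_imp, hmoved.optimal_iff (hx i) hXstarBall, forall_eq]
    simp only [hmemB]
    obtain rfl : s = fun i => orbit (x i) := funext hsx
    simp only [hmoved.isMeanPartition_iff hn hlab hx, forall_eq]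
    simp only [← and_imp, hmoved.optimal_iff (frobNorm_average_sub_lt hn hx) hXstarBall, forall_eq]
    rw [← half_lt_mean_iff hn _ fun i => inner_eq_zero_or_one (hlab i) (hard i)
      (hXstarHard.2 Xb hXb) j, Finset.sum_comm, Finset.mul_sum]
    simp only [average_apply, ← Finset.sum_mul, mul_assoc]
  have hprob : ∀ n : ℕ, 0 < n → majorityProb pj n = ((Measure.pi fun _ : Fin n => Q)
      {s | ∀ M, IsMeanPartition s M → ∀ M' ∈ M, frobNorm (M' - Xb) = pdist M (orbit Xb) →
        1 / 2 < ∑ k, M' k j * Xb k j}).toReal := by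
    intro n hn
    rw [hpj, ← measureReal_def, ← pi_majority_eq Q MeasurableSpace.measurableSet_top n, measureReal_def]
    have hae : ∀ᵐ A ∂Q, IsHard A ∧ pdist A Z < asym Z / 4 :=
      (mem_ae_iff_prob_eq_one MeasurableSpace.measurableSet_top).2 hsupp
    have hall : ∀ᵐ s ∂(Measure.pi fun _ : Fin n => Q),
        ∀ i, IsHard (s i) ∧ pdist (s i) Z < asym Z / 4 :=
      ae_all_iff.2 fun i =>
        (measurePreserving_eval (fun _ : Fin n => Q) i).quasiMeasurePreserving.ae hae
    congr 1
    refine measure_congr (eventuallyEq_set.2 ?_)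
    filter_upwards [hall] with s hs
    convert (hvote n hn s hs).symm
  have hlim : ∀ c, Tendsto (majorityProb pj) atTop (nhds c) → _ := fun c hc =>
    hc.congr' ((eventually_gt_atTop 0).mono hprob)
  have hp₀ : 0 ≤ pj := hpj ▸ ENNReal.toReal_nonneg
  have hp₁ : pj ≤ 1 := hpj ▸ measureReal_le_one
  refine ⟨fun n hn s hs => ?_, fun h => hlim _ (tendsto_majorityProb_of_gt hp₁ h),
    fun h => hlim _ (tendsto_majorityProb_of_lt hp₀ h),
    fun h => hlim _ (h ▸ tendsto_majorityProb_half)⟩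
  choose x hsx hlab hx _ using fun i => hgood (s i) (hs i)
  obtain rfl : s = fun i => orbit (x i) := funext hsx
  simp only [hmoved.isMeanPartition_iff hn hlab hx, existsUnique_eq, forall_eq,
    hmoved.optimal_iff (frobNorm_average_sub_lt hn hx) hXstarBall, and_self]

end CJT
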